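/- Let n ≥ 1 be an integer, N = dim Π_n^q, C ⊂ S^q a finite set, and ν a measure supported on C with masses v_ξ := ν({ξ}), satisfying c₁ ‖P‖_{L^p(μ_q)} ≤ (Σ_{ξ∈C} v_ξ |P(ξ)|^p)^{1/p} ≤ c₂ ‖P‖_{L^p(μ_q)} for all P ∈ Π_n^q and 1 ≤ p ≤ ∞. Assume in addition that |Σ_{ξ∈C} v_ξ P(ξ)² − ∫_{S^q} P² dμ_q| ≤ (c₀/n^q) ∫_{S^q} P² dμ_q for all P ∈ Π_n^q. Then there is a constant c > 0, depending only on q, c₀, c₁, c₂, such that |w_ξ^{LSQ}| ≤ c v_ξ for every ξ ∈ C; in particular the weights (w_ξ^{LSQ}) satisfy the M–Z condition (Σ_{ξ∈C} |w_ξ^{LSQ}| |P(ξ)|^p)^{1/p} ≤ c' ‖P‖_{L^p(μ_q)} for all P ∈ Π_n^q and 1 ≤ p < ∞. -/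

import Mathlib

noncomputable section

open MeasureTheory Finset

namespace SD

/-- Euclidean space `ℝ^(q+1)`. -/
abbrev Euc (q : ℕ) := EuclideanSpace ℝ (Fin (q + 1))

/-- The unit sphere `S^q ⊂ ℝ^(q+1)`, as a type. -/
abbrev Sph (q : ℕ) : Type := Metric.sphere (0 : Euc q) 1

/-- Dot product of two points of the sphere. -/
def dot {q : ℕ} (x y : Sph q) : ℝ := ∑ i, (x : Euc q) i * (y : Euc q) i

/-- Geodesic distance `arccos (x ⬝ y)` on the sphere. -/
def gdist {q : ℕ} (x y : Sph q) : ℝ := Real.arccos (dot x y)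

/-- The mesh norm `δ_C(S^q)` of a finite set of points. -/
def meshNorm {q : ℕ} (C : Finset (Sph q)) : ℝ :=
  ⨆ x : Sph q, sInf ((fun ξ => gdist x ξ) '' (C : Set (Sph q)))

/-- `f : S^q → ℝ` belongs to `Π_n^q` : it is the restriction to the sphere of an algebraic
polynomial in `q+1` variables of total degree at most `n`. -/
def InPi (q n : ℕ) (f : Sph q → ℝ) : Prop :=
  ∃ P : MvPolynomial (Fin (q + 1)) ℝ, P.totalDegree ≤ n ∧
    ∀ x : Sph q, f x = MvPolynomial.eval (fun i => (x : Euc q) i) P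

/-- `f` is a spherical harmonic of degree `ℓ` : the restriction to the sphere of a
homogeneous harmonic polynomial of degree `ℓ`. -/
def IsSphHarm (q ℓ : ℕ) (f : Sph q → ℝ) : Prop :=
  ∃ P : MvPolynomial (Fin (q + 1)) ℝ, P.IsHomogeneous ℓ ∧
    (∑ i : Fin (q + 1), MvPolynomial.pderiv i (MvPolynomial.pderiv i P)) = 0 ∧
    ∀ x : Sph q, f x = MvPolynomial.eval (fun i => (x : Euc q) i) P

/-- Rotation of a point of the sphere by a linear isometry of the ambient space. -/
def rotate {q : ℕ} (R : Euc q ≃ₗᵢ[ℝ] Euc q) (x : Sph q) : Sph q :=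
  ⟨R x, by
    have hx : ‖(x : Euc q)‖ = 1 := mem_sphere_zero_iff_norm.mp x.2
    simp [mem_sphere_zero_iff_norm, hx]⟩

/-- `μ` is invariant under all rotations of the sphere. -/
def RotInvariant (q : ℕ) (μ : Measure (Sph q)) : Prop :=
  ∀ R : Euc q ≃ₗᵢ[ℝ] Euc q, Measure.map (rotate R) μ = μ

/-- `IterIntBV S f` : `f` is an `S` times iterated integral of a function of bounded
variation (on `[0,∞)`). -/
def IterIntBV : ℕ → (ℝ → ℝ) → Prop
  | 0, f => BoundedVariationOn f (Set.Ici 0)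
  | (S + 1), f => ∃ g : ℝ → ℝ, IterIntBV S g ∧ ∀ x : ℝ, 0 ≤ x → f x = f 0 + ∫ t in (0 : ℝ)..x, g t

/-- The standing hypotheses on the filter function `h` : `h = 1` on `[0,1/2]`, `h = 0` on
`(1,∞)`, `h` nonincreasing on `[0,∞)`, and `h` an `S` times iterated integral of a function
of bounded variation. -/
def GoodH (S : ℕ) (h : ℝ → ℝ) : Prop :=
  (∀ x : ℝ, 0 ≤ x → x ≤ 1 / 2 → h x = 1) ∧
  (∀ x : ℝ, 1 < x → h x = 0) ∧
  (∀ x y : ℝ, 0 ≤ x → x ≤ y → h y ≤ h x) ∧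
  IterIntBV S h

/-- `Y ℓ ·` is, for each `ℓ`, an orthonormal basis of the space of degree `ℓ` spherical
harmonics in `L²(μ)`. -/
def GoodBasis (q : ℕ) (μ : Measure (Sph q)) (d : ℕ → ℕ)
    (Y : (ℓ : ℕ) → Fin (d ℓ) → Sph q → ℝ) : Prop :=
  (∀ ℓ k, IsSphHarm q ℓ (Y ℓ k)) ∧
  (∀ (ℓ ℓ' : ℕ) (k : Fin (d ℓ)) (k' : Fin (d ℓ')),
      ∫ x, Y ℓ k x * Y ℓ' k' x ∂μ = if ℓ = ℓ' ∧ (k : ℕ) = (k' : ℕ) then 1 else 0) ∧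
  (∀ (ℓ : ℕ) (f : Sph q → ℝ), IsSphHarm q ℓ f →
      ∃ a : Fin (d ℓ) → ℝ, ∀ x, f x = ∑ k, a k * Y ℓ k x)

/-- The kernel `Φ_n(h; x·ξ) = Σ_{ℓ=0}^n h(ℓ/n) Σ_k Y_{ℓ,k}(x) Y_{ℓ,k}(ξ)`. -/
def Phi {q : ℕ} (d : ℕ → ℕ) (Y : (ℓ : ℕ) → Fin (d ℓ) → Sph q → ℝ) (h : ℝ → ℝ) (n : ℕ)
    (x ξ : Sph q) : ℝ :=
  ∑ ℓ ∈ range (n + 1), h ((ℓ : ℝ) / (n : ℝ)) * ∑ k, Y ℓ k x * Y ℓ k ξ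

/-- The discretized operator `σ_n(C, W; h; Z, x) = Σ_{ξ∈C} w_ξ z_ξ Φ_n(h; x·ξ)`. -/
def sigmaOp {q : ℕ} (d : ℕ → ℕ) (Y : (ℓ : ℕ) → Fin (d ℓ) → Sph q → ℝ) (h : ℝ → ℝ) (n : ℕ)
    (C : Finset (Sph q)) (w : Sph q → ℝ) (z : Sph q → ℝ) (x : Sph q) : ℝ :=
  ∑ ξ ∈ C, w ξ * z ξ * Phi d Y h n x ξ

/-- The summability operator `σ*_n(h; f, x) = ∫ f(ζ) Φ_n(h; x·ζ) dμ(ζ)`. -/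
def sigmaStar {q : ℕ} (μ : Measure (Sph q)) (d : ℕ → ℕ)
    (Y : (ℓ : ℕ) → Fin (d ℓ) → Sph q → ℝ) (h : ℝ → ℝ) (n : ℕ) (f : Sph q → ℝ)
    (x : Sph q) : ℝ :=
  ∫ ζ, f ζ * Phi d Y h n x ζ ∂μ

/-- Sup norm on the sphere. -/
def supNorm {q : ℕ} (f : Sph q → ℝ) : ℝ := ⨆ x : Sph q, |f x|

/-- Sup norm on a subset of the sphere. -/
def supNormOn {q : ℕ} (K : Set (Sph q)) (f : Sph q → ℝ) : ℝ := ⨆ x ∈ K, |f x|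

/-- The spherical cap of radius `δ` centered at `x₀`. -/
def cap {q : ℕ} (x₀ : Sph q) (δ : ℝ) : Set (Sph q) := {x | gdist x x₀ ≤ δ}

/-- `C` admits a Marcinkiewicz–Zygmund quadrature of order `m` with weights `w` and
M–Z constant `c₀`. -/
def MZQuad (q : ℕ) (μ : Measure (Sph q)) (m : ℕ) (C : Finset (Sph q)) (w : Sph q → ℝ)
    (c₀ : ℝ) : Prop :=
  (∀ P : Sph q → ℝ, InPi q (2 * m) P → ∑ ξ ∈ C, w ξ * P ξ = ∫ x, P x ∂μ) ∧
  (∀ P : Sph q → ℝ, InPi q (2 * m) P → ∀ p : ℝ, 1 ≤ p →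
      (∑ ξ ∈ C, |w ξ| * |P ξ| ^ p) ^ (1 / p) ≤ c₀ * (∫ x, |P x| ^ p ∂μ) ^ (1 / p))

/-- The sequence `n ↦ 2^((n+1)r) ‖σ*_{2^(n+1)}(h;f) − σ*_{2^n}(h;f)‖_{∞,K}`. -/
def WrSeqOn {q : ℕ} (K : Set (Sph q)) (μ : Measure (Sph q)) (d : ℕ → ℕ)
    (Y : (ℓ : ℕ) → Fin (d ℓ) → Sph q → ℝ) (h : ℝ → ℝ) (r : ℝ) (f : Sph q → ℝ) (n : ℕ) : ℝ :=
  (2 : ℝ) ^ (((n : ℝ) + 1) * r) *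
    supNormOn K (fun x => sigmaStar μ d Y h (2 ^ (n + 1)) f x - sigmaStar μ d Y h (2 ^ n) f x)

/-- The norm `‖f‖_{W_r(K)}`. -/
def WrNormOn {q : ℕ} (K : Set (Sph q)) (μ : Measure (Sph q)) (d : ℕ → ℕ)
    (Y : (ℓ : ℕ) → Fin (d ℓ) → Sph q → ℝ) (h : ℝ → ℝ) (r : ℝ) (f : Sph q → ℝ) : ℝ :=
  supNorm f + ⨆ n : ℕ, WrSeqOn K μ d Y h r f n

/-- The norm `‖f‖_{W_r}`. -/
def WrNorm {q : ℕ} (μ : Measure (Sph q)) (d : ℕ → ℕ)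
    (Y : (ℓ : ℕ) → Fin (d ℓ) → Sph q → ℝ) (h : ℝ → ℝ) (r : ℝ) (f : Sph q → ℝ) : ℝ :=
  WrNormOn Set.univ μ d Y h r f

/-- Membership in `W_r(K)` : `f` is continuous and the `W_r(K)` seminorm is finite. -/
def MemWrOn {q : ℕ} (K : Set (Sph q)) (μ : Measure (Sph q)) (d : ℕ → ℕ)
    (Y : (ℓ : ℕ) → Fin (d ℓ) → Sph q → ℝ) (h : ℝ → ℝ) (r : ℝ) (f : Sph q → ℝ) : Prop :=
  Continuous f ∧ BddAbove (Set.range (WrSeqOn K μ d Y h r f))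

/-- `y` is an orthonormal basis of `Π_n^q` in `L²(μ)` (so `N = dim Π_n^q`), whose `0`-th
element is the constant polynomial `1`. -/
def GoodPolyBasis (q n N : ℕ) (μ : Measure (Sph q)) (y : Fin N → Sph q → ℝ) : Prop :=
  (∀ i, InPi q n (y i)) ∧
  (∀ i j, ∫ x, y i x * y j x ∂μ = if i = j then 1 else 0) ∧
  (∀ P : Sph q → ℝ, InPi q n P → ∃ a : Fin N → ℝ, ∀ x, P x = ∑ i, a i * y i x) ∧
  (∀ i : Fin N, (i : ℕ) = 0 → ∀ x, y i x = 1)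

/-- The Gram matrix `(G_N)_{i,j} = Σ_{ξ∈C} v_ξ y_i(ξ) y_j(ξ)`. -/
def gram {q N : ℕ} (C : Finset (Sph q)) (v : Sph q → ℝ) (y : Fin N → Sph q → ℝ) :
    Matrix (Fin N) (Fin N) ℝ :=
  Matrix.of fun i j => ∑ ξ ∈ C, v ξ * y i ξ * y j ξ

/-- The least squares quadrature weights `w_ξ^{LSQ} = v_ξ Σ_k (G_N⁻¹)_{i₀,k} y_k(ξ)`. -/
def wLSQ {q N : ℕ} (C : Finset (Sph q)) (v : Sph q → ℝ) (y : Fin N → Sph q → ℝ) (i0 : Fin N)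
    (ξ : Sph q) : ℝ :=
  v ξ * ∑ k, (gram C v y)⁻¹ i0 k * y k ξ

/-- Two–sided Marcinkiewicz–Zygmund inequalities for the masses `v` on `C`, for all
`1 ≤ p ≤ ∞`. -/
def VMZ (q n : ℕ) (μ : Measure (Sph q)) (C : Finset (Sph q)) (v : Sph q → ℝ)
    (c₁ c₂ : ℝ) : Prop :=
  (∀ P : Sph q → ℝ, InPi q n P → ∀ p : ℝ, 1 ≤ p →
      c₁ * (∫ x, |P x| ^ p ∂μ) ^ (1 / p) ≤ (∑ ξ ∈ C, v ξ * |P ξ| ^ p) ^ (1 / p) ∧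
      (∑ ξ ∈ C, v ξ * |P ξ| ^ p) ^ (1 / p) ≤ c₂ * (∫ x, |P x| ^ p ∂μ) ^ (1 / p)) ∧
  (∀ P : Sph q → ℝ, InPi q n P →
      c₁ * supNorm P ≤ (⨆ ξ ∈ (C : Set (Sph q)), |P ξ|) ∧
      (⨆ ξ ∈ (C : Set (Sph q)), |P ξ|) ≤ c₂ * supNorm P)

lemma InPi.continuous {q n : ℕ} {f : Sph q → ℝ} (hf : InPi q n f) : Continuous f := by
  obtain ⟨P, -, h⟩ := hf
  rw [funext h]
  exact (MvPolynomial.continuous_eval P).comp (by fun_prop)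

lemma InPi.sum_mul {q n : ℕ} {ι : Type*} [Fintype ι] {y : ι → Sph q → ℝ}
    (hy : ∀ i, InPi q n (y i)) (a : ι → ℝ) : InPi q n (fun x => ∑ i, a i * y i x) := by
  choose P hP hev using hy
  refine ⟨∑ i, a i • P i, MvPolynomial.totalDegree_finsetSum_le fun i _ =>
    (MvPolynomial.totalDegree_smul_le _ _).trans (hP i), fun x => ?_⟩
  simp [hev, MvPolynomial.smul_eval]

lemma InPi.linear_combination {q n : ℕ} {f g : Sph q → ℝ} (hf : InPi q n f) (hg : InPi q n g)
    (s t : ℝ) : InPi q n (fun x => s * f x + t * g x) := by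
  have := InPi.sum_mul (n := n) (y := ![f, g]) (Fin.forall_fin_two.2 ⟨hf, hg⟩) ![s, t]
  simpa [Fin.sum_univ_two] using this

lemma totalDegree_bind₁_le {σ : Type*} [Fintype σ] {L : σ → MvPolynomial σ ℝ}
    (hL : ∀ i, (L i).totalDegree ≤ 1) (P : MvPolynomial σ ℝ) :
    (MvPolynomial.bind₁ L P).totalDegree ≤ P.totalDegree := by
  conv_lhs => rw [P.as_sum, map_sum]
  refine MvPolynomial.totalDegree_finsetSum_le fun s hs => ?_
  rw [MvPolynomial.bind₁_monomial]
  refine (MvPolynomial.totalDegree_mul _ _).trans ?_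
  rw [MvPolynomial.totalDegree_C, zero_add]
  refine (MvPolynomial.totalDegree_finsetProd _ _).trans
    (le_trans ?_ (MvPolynomial.le_totalDegree hs))
  refine Finset.sum_le_sum fun i _ => (MvPolynomial.totalDegree_pow _ _).trans ?_
  simpa using Nat.mul_le_mul_left (s i) (hL i)

lemma InPi.comp_rotate {q n : ℕ} {f : Sph q → ℝ} (hf : InPi q n f)
    (R : Euc q ≃ₗᵢ[ℝ] Euc q) : InPi q n (fun x => f (rotate R x)) := by
  obtain ⟨P, hP, hev⟩ := hf
  let L : Fin (q + 1) → MvPolynomial (Fin (q + 1)) ℝ := fun i =>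
    ∑ j, (R (EuclideanSpace.single j 1)) i • MvPolynomial.X j
  refine ⟨MvPolynomial.bind₁ L P, (totalDegree_bind₁_le (fun i => ?_) P).trans hP, fun x => ?_⟩
  · exact MvPolynomial.totalDegree_finsetSum_le fun j _ =>
      (MvPolynomial.totalDegree_smul_le _ _).trans (MvPolynomial.totalDegree_X _).le
  · beta_reduce
    rw [hev, ← MvPolynomial.coe_aeval_eq_eval, ← MvPolynomial.coe_aeval_eq_eval]
    simp only [RingHom.coe_coe, MvPolynomial.aeval_bind₁]
    congr 2
    funext i
    have hx : (x : Euc q) = ∑ j, (x : Euc q) j • EuclideanSpace.single j (1 : ℝ) := by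
      ext k
      simp [Finset.sum_apply, Pi.single_apply]
    have : (R (x : Euc q)) i = ∑ j, (x : Euc q) j * (R (EuclideanSpace.single j (1 : ℝ))) i := by
      conv_lhs => rw [hx, map_sum]
      simp
    simp [rotate, L, this, mul_comm]

lemma continuous_rotate {q : ℕ} (R : Euc q ≃ₗᵢ[ℝ] Euc q) : Continuous (rotate R) :=
  (R.continuous.comp continuous_subtype_val).subtype_mk _

lemma exists_rotate_eq {q : ℕ} (x z : Sph q) : ∃ R : Euc q ≃ₗᵢ[ℝ] Euc q, rotate R x = z := by
  have hx : ‖(x : Euc q)‖ = ‖(z : Euc q)‖ := by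
    rw [mem_sphere_zero_iff_norm.mp x.2, mem_sphere_zero_iff_norm.mp z.2]
  exact ⟨_, Subtype.ext (Submodule.reflection_sub hx)⟩

lemma integrable_of_continuous {q : ℕ} {μ : Measure (Sph q)} [IsProbabilityMeasure μ]
    {f : Sph q → ℝ} (hf : Continuous f) : Integrable f μ :=
  hf.integrable_of_hasCompactSupport (HasCompactSupport.of_compactSpace f)

lemma RotInvariant.integral_comp {q : ℕ} {μ : Measure (Sph q)} (h : RotInvariant q μ)
    (R : Euc q ≃ₗᵢ[ℝ] Euc q) {f : Sph q → ℝ} (hf : Continuous f) :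
    ∫ x, f (rotate R x) ∂μ = ∫ x, f x ∂μ := by
  conv_rhs => rw [← h R]
  exact (integral_map (continuous_rotate R).aemeasurable
    hf.aestronglyMeasurable).symm

lemma integral_sum_mul_sum {q n N : ℕ} {μ : Measure (Sph q)} [IsProbabilityMeasure μ]
    {y : Fin N → Sph q → ℝ} (hy : GoodPolyBasis q n N μ y) (a b : Fin N → ℝ) :
    ∫ x, (∑ i, a i * y i x) * (∑ i, b i * y i x) ∂μ = ∑ i, a i * b i := by
  have hc := fun i => (hy.1 i).continuous
  simp_rw [Finset.sum_mul_sum]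
  rw [integral_finsetSum _ fun i _ => integrable_of_continuous (by fun_prop)]
  refine Finset.sum_congr rfl fun i _ => ?_
  rw [integral_finsetSum _ fun j _ => integrable_of_continuous (by fun_prop)]
  have (j : Fin N) : ∫ x, a i * y i x * (b j * y j x) ∂μ = a i * b j * if i = j then 1 else 0 := by
    rw [← hy.2.1 i j, ← integral_const_mul]
    exact integral_congr_ae (.of_forall fun x => by ring)
  simp [this]

lemma integral_sum_sq {q n N : ℕ} {μ : Measure (Sph q)} [IsProbabilityMeasure μ]
    {y : Fin N → Sph q → ℝ} (hy : GoodPolyBasis q n N μ y) (a : Fin N → ℝ) :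
    ∫ x, (∑ i, a i * y i x) ^ 2 ∂μ = ∑ i, a i ^ 2 := by
  simp_rw [sq]
  exact integral_sum_mul_sum hy a a

/-- The diagonal of the reproducing kernel of `Π_n^q` is bounded by the dimension. -/
lemma GoodPolyBasis.sum_sq_le {q n N : ℕ} {μ : Measure (Sph q)} [IsProbabilityMeasure μ]
    (hrot : RotInvariant q μ) {y : Fin N → Sph q → ℝ} (hy : GoodPolyBasis q n N μ y)
    (ξ : Sph q) : ∑ i, y i ξ ^ 2 ≤ N := by
  have hc := fun i => (hy.1 i).continuous
  have key (x : Sph q) : ∑ i, y i ξ ^ 2 ≤ ∑ i, y i x ^ 2 := by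
    obtain ⟨R, rfl⟩ := exists_rotate_eq x ξ
    set a : Fin N → ℝ := fun i => y i (rotate R x)
    obtain ⟨b, hb⟩ := hy.2.2.1 _ ((InPi.sum_mul hy.1 a).comp_rotate R)
    have hab : ∑ i, a i ^ 2 = ∑ i, b i ^ 2 := by
      rw [← integral_sum_sq hy a, ← integral_sum_sq hy b,
        ← hrot.integral_comp R (f := fun x => (∑ i, a i * y i x) ^ 2) (by fun_prop)]
      exact integral_congr_ae (.of_forall fun z => by simp only [hb z])
    have hx : ∑ i, a i ^ 2 = ∑ i, b i * y i x := by
      rw [← hb x]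
      exact Finset.sum_congr rfl fun i _ => sq _
    have hcs := Finset.sum_mul_sq_le_sq_mul_sq Finset.univ b (fun i => y i x)
    rw [← hx, ← hab, sq] at hcs
    rcases (Finset.sum_nonneg fun i _ => sq_nonneg (a i) :
      0 ≤ ∑ i, a i ^ 2).eq_or_lt with h0 | h0
    · rw [← h0]
      positivity
    · exact le_of_mul_le_mul_left hcs h0
  have h := integral_mono (μ := μ) (integrable_const (∑ i, y i ξ ^ 2))
    (integrable_of_continuous (f := fun x => ∑ i, y i x ^ 2) (by fun_prop)) key
  have hN : ∫ x, ∑ i, y i x ^ 2 ∂μ = N := by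
    rw [integral_finsetSum _ fun i _ => integrable_of_continuous (by fun_prop)]
    simp [sq, hy.2.1]
  simpa [hN] using h

lemma GoodPolyBasis.linearIndependent {q n N : ℕ} {μ : Measure (Sph q)} [IsProbabilityMeasure μ]
    {y : Fin N → Sph q → ℝ} (hy : GoodPolyBasis q n N μ y) : LinearIndependent ℝ y := by
  rw [Fintype.linearIndependent_iff]
  intro a ha i
  have h0 (x : Sph q) : ∑ i, a i * y i x = 0 := by
    simpa using congrFun ha x
  have := integral_sum_sq hy a
  simp only [h0, ne_eq, OfNat.ofNat_ne_zero, not_false_eq_true, zero_pow, integral_zero] at this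
  have := (Finset.sum_eq_zero_iff_of_nonneg fun i _ => sq_nonneg (a i)).1 this.symm i
    (Finset.mem_univ i)
  simpa using this

lemma GoodPolyBasis.card_le {q n N : ℕ} {μ : Measure (Sph q)} [IsProbabilityMeasure μ]
    {y : Fin N → Sph q → ℝ} (hy : GoodPolyBasis q n N μ y) : N ≤ (n + 1) ^ (q + 1) := by
  classical
  let m : (Fin (q + 1) → Fin (n + 1)) → Sph q → ℝ := fun s x => ∏ i, (x : Euc q) i ^ (s i : ℕ)
  let w : Finset (Sph q → ℝ) := Finset.univ.image m
  have hspan : Set.range y ≤ Submodule.span ℝ (w : Set (Sph q → ℝ)) := by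
    rintro _ ⟨k, rfl⟩
    obtain ⟨P, hP, hev⟩ := hy.1 k
    have : y k = ∑ d ∈ P.support, P.coeff d • fun x : Sph q => ∏ i, (x : Euc q) i ^ d i := by
      funext x
      simp [hev, MvPolynomial.eval_eq', Finset.sum_apply]
    rw [this]
    refine Submodule.sum_mem _ fun d hd => Submodule.smul_mem _ _ (Submodule.subset_span ?_)
    have hdeg (i : Fin (q + 1)) : d i < n + 1 :=
      Nat.lt_succ_of_le (((Finsupp.le_degree i d).trans
        (MvPolynomial.le_totalDegree hd)).trans hP)
    exact Finset.mem_coe.2 (Finset.mem_image.2 ⟨fun i => ⟨d i, hdeg i⟩, Finset.mem_univ _, rfl⟩)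
  have h := linearIndependent_le_span_aux' y hy.linearIndependent (w : Set (Sph q → ℝ)) hspan
  rw [Fintype.card_fin] at h
  simp only [Finset.coe_sort_coe, Fintype.card_coe] at h
  refine h.trans (Finset.card_image_le.trans ?_)
  simp

lemma GoodPolyBasis.card_le_pow {q n N : ℕ} (hq : 1 ≤ q) (hn : 1 ≤ n) {μ : Measure (Sph q)}
    [IsProbabilityMeasure μ] {y : Fin N → Sph q → ℝ} (hy : GoodPolyBasis q n N μ y) :
    N ≤ (2 ^ (q + 1) * n ^ q) ^ 2 := by
  calc N ≤ (n + 1) ^ (q + 1) := hy.card_le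
    _ ≤ (2 * n) ^ (q + 1) := Nat.pow_le_pow_left (by omega) _
    _ = 2 ^ (q + 1) * n ^ (q + 1) := mul_pow _ _ _
    _ ≤ 2 ^ ((q + 1) * 2) * n ^ (q * 2) :=
      Nat.mul_le_mul (Nat.pow_le_pow_right (by norm_num) (by omega))
        (Nat.pow_le_pow_right hn (by omega))
    _ = (2 ^ (q + 1) * n ^ q) ^ 2 := by rw [mul_pow, ← pow_mul, ← pow_mul]

lemma VMZ.integral_sq_le {q n : ℕ} {μ : Measure (Sph q)} {C : Finset (Sph q)} {v : Sph q → ℝ}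
    {c₁ c₂ : ℝ} (hc₁ : 0 < c₁) (hv : ∀ ξ ∈ C, 0 ≤ v ξ) (h : VMZ q n μ C v c₁ c₂)
    {P : Sph q → ℝ} (hP : InPi q n P) :
    c₁ ^ 2 * ∫ x, P x ^ 2 ∂μ ≤ ∑ ξ ∈ C, v ξ * P ξ ^ 2 := by
  have h2 := (h.1 P hP 2 (by norm_num)).1
  simp only [Real.rpow_two, sq_abs, ← Real.sqrt_eq_rpow] at h2
  have hI : 0 ≤ ∫ x, P x ^ 2 ∂μ := integral_nonneg fun x => sq_nonneg _
  have hS : 0 ≤ ∑ ξ ∈ C, v ξ * P ξ ^ 2 :=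
    Finset.sum_nonneg fun ξ hξ => mul_nonneg (hv ξ hξ) (sq_nonneg _)
  have := pow_le_pow_left₀ (by positivity) h2 2
  rwa [mul_pow, Real.sq_sqrt hI, Real.sq_sqrt hS] at this

lemma gram_det_ne_zero {q n N : ℕ} {μ : Measure (Sph q)} [IsProbabilityMeasure μ]
    {y : Fin N → Sph q → ℝ} (hy : GoodPolyBasis q n N μ y) {C : Finset (Sph q)}
    {v : Sph q → ℝ} {c₁ c₂ : ℝ} (hc₁ : 0 < c₁) (hv : ∀ ξ ∈ C, 0 ≤ v ξ)
    (h : VMZ q n μ C v c₁ c₂) : (gram C v y).det ≠ 0 := by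
  intro hdet
  obtain ⟨a, ha0, ha⟩ := Matrix.exists_mulVec_eq_zero_iff.2 hdet
  have hle := h.integral_sq_le hc₁ hv (InPi.sum_mul hy.1 a)
  rw [integral_sum_sq hy] at hle
  have hS : ∑ ξ ∈ C, v ξ * (∑ i, a i * y i ξ) ^ 2
      = ∑ i, a i * (gram C v y).mulVec a i := by
    simp only [Matrix.mulVec, dotProduct, gram, Matrix.of_apply, sq,
      Finset.mul_sum, Finset.sum_mul]
    rw [Finset.sum_comm]
    refine Finset.sum_congr rfl fun i _ => ?_
    rw [Finset.sum_comm]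
    exact Finset.sum_congr rfl fun j _ => Finset.sum_congr rfl fun ξ _ => by ring
  rw [hS, ha] at hle
  simp only [Pi.zero_apply, mul_zero, Finset.sum_const_zero] at hle
  have h0 : ∑ i, a i ^ 2 = 0 :=
    le_antisymm (nonpos_of_mul_nonpos_right hle (by positivity))
      (Finset.sum_nonneg fun i _ => sq_nonneg _)
  refine ha0 (funext fun i => ?_)
  simpa using (Finset.sum_eq_zero_iff_of_nonneg fun i _ => sq_nonneg (a i)).1 h0 i
    (Finset.mem_univ i)

/-- The density of the least squares weights is the `ν`-representer of the mean. -/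
lemma sum_density_mul {q n N : ℕ} {μ : Measure (Sph q)} [IsProbabilityMeasure μ]
    {y : Fin N → Sph q → ℝ} (hN : 0 < N) (hy : GoodPolyBasis q n N μ y) {C : Finset (Sph q)}
    {v : Sph q → ℝ} (hdet : (gram C v y).det ≠ 0) {P : Sph q → ℝ} (hP : InPi q n P) :
    ∑ ξ ∈ C, v ξ * ((∑ k, (gram C v y)⁻¹ ⟨0, hN⟩ k * y k ξ) * P ξ) = ∫ x, P x ∂μ := by
  obtain ⟨a, ha⟩ := hy.2.2.1 P hP
  set b : Fin N → ℝ := (gram C v y)⁻¹ ⟨0, hN⟩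
  have hb (j : Fin N) : ∑ k, b k * gram C v y k j = if ⟨0, hN⟩ = j then 1 else 0 := by
    have := congrFun (congrFun (Matrix.nonsing_inv_mul _ hdet.isUnit) ⟨0, hN⟩) j
    rwa [Matrix.mul_apply, Matrix.one_apply] at this
  have hI : ∫ x, P x ∂μ = a ⟨0, hN⟩ := by
    have := integral_sum_mul_sum hy a (Pi.single ⟨0, hN⟩ 1)
    simpa [Pi.single_apply, hy.2.2.2 ⟨0, hN⟩ rfl, ← ha] using this
  have hS : ∑ ξ ∈ C, v ξ * ((∑ k, b k * y k ξ) * P ξ)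
      = ∑ j, a j * ∑ k, b k * gram C v y k j := by
    simp only [ha, gram, Matrix.of_apply, Finset.mul_sum, Finset.sum_mul]
    rw [Finset.sum_comm]
    refine Finset.sum_congr rfl fun j _ => ?_
    rw [Finset.sum_comm]
    exact Finset.sum_congr rfl fun k _ => Finset.sum_congr rfl fun ξ _ => by ring
  rw [hS, hI]
  simp [hb]

lemma GoodPolyBasis.sq_le_integral {q n N : ℕ} {μ : Measure (Sph q)} [IsProbabilityMeasure μ]
    (hrot : RotInvariant q μ) {y : Fin N → Sph q → ℝ} (hy : GoodPolyBasis q n N μ y)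
    {P : Sph q → ℝ} (hP : InPi q n P) (ξ : Sph q) : P ξ ^ 2 ≤ N * ∫ x, P x ^ 2 ∂μ := by
  obtain ⟨a, ha⟩ := hy.2.2.1 P hP
  simp only [ha]
  rw [integral_sum_sq hy, mul_comm]
  exact (Finset.sum_mul_sq_le_sq_mul_sq _ _ _).trans
    (mul_le_mul_of_nonneg_left (hy.sum_sq_le hrot ξ) (Finset.sum_nonneg fun i _ => sq_nonneg _))

/-- If the discrete and continuous quadratic forms on `Π_n^q` differ by at most `ε`, then the
corresponding means differ by at most `ε` relative to the `L²` norm. -/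
lemma two_mul_sub_le {q n : ℕ} {μ : Measure (Sph q)} [IsProbabilityMeasure μ]
    {C : Finset (Sph q)} {v : Sph q → ℝ} {ε : ℝ}
    (h : ∀ P : Sph q → ℝ, InPi q n P →
      |(∑ ξ ∈ C, v ξ * P ξ ^ 2) - ∫ x, P x ^ 2 ∂μ| ≤ ε * ∫ x, P x ^ 2 ∂μ)
    (h1 : InPi q n fun _ => 1) {D : Sph q → ℝ} (hD : InPi q n D) (t : ℝ) :
    2 * t * (∫ x, D x ∂μ - ∑ ξ ∈ C, v ξ * D ξ) ≤ ε * (1 + t ^ 2 * ∫ x, D x ^ 2 ∂μ) := by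
  have hc := hD.continuous
  have hint (s : ℝ) : ∫ x, (1 * 1 + s * D x) ^ 2 ∂μ
      = 1 + 2 * s * ∫ x, D x ∂μ + s ^ 2 * ∫ x, D x ^ 2 ∂μ := by
    have : ∀ x, (1 * 1 + s * D x) ^ 2 = 1 + 2 * s * D x + s ^ 2 * D x ^ 2 := fun x => by ring
    simp_rw [this]
    rw [integral_add (integrable_of_continuous (by fun_prop))
      (integrable_of_continuous (by fun_prop)), integral_add
      (integrable_of_continuous (by fun_prop)) (integrable_of_continuous (by fun_prop)),
      integral_const_mul, integral_const_mul]
    simp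
  have hsum (s : ℝ) : ∑ ξ ∈ C, v ξ * (1 * 1 + s * D ξ) ^ 2
      = ∑ ξ ∈ C, v ξ + 2 * s * ∑ ξ ∈ C, v ξ * D ξ + s ^ 2 * ∑ ξ ∈ C, v ξ * D ξ ^ 2 := by
    rw [Finset.mul_sum, Finset.mul_sum, ← Finset.sum_add_distrib, ← Finset.sum_add_distrib]
    exact Finset.sum_congr rfl fun ξ _ => by ring
  have hp := h _ (h1.linear_combination hD 1 t)
  have hm := h _ (h1.linear_combination hD 1 (-t))
  simp only [hint, hsum] at hp hm
  have hp := (abs_le.1 hp).1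
  have hm := (abs_le.1 hm).2
  nlinarith

/-- The density `w_ξ^{LSQ} / v_ξ` is uniformly bounded. -/
lemma abs_density_le {q n N : ℕ} (hq : 1 ≤ q) (hn : 1 ≤ n) (hN : 0 < N) {μ : Measure (Sph q)}
    [IsProbabilityMeasure μ] (hrot : RotInvariant q μ) {c₀ c₁ c₂ : ℝ} (hc₀ : 0 < c₀)
    (hc₁ : 0 < c₁) {y : Fin N → Sph q → ℝ} (hy : GoodPolyBasis q n N μ y)
    {C : Finset (Sph q)} {v : Sph q → ℝ} (hv : ∀ ξ ∈ C, 0 ≤ v ξ) (hMZ : VMZ q n μ C v c₁ c₂)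
    (h : ∀ P : Sph q → ℝ, InPi q n P →
      |(∑ ξ ∈ C, v ξ * P ξ ^ 2) - ∫ x, P x ^ 2 ∂μ| ≤ c₀ / (n : ℝ) ^ q * ∫ x, P x ^ 2 ∂μ)
    (ξ : Sph q) :
    |∑ k, (gram C v y)⁻¹ ⟨0, hN⟩ k * y k ξ| ≤ 1 + 2 ^ (q + 1) * c₀ / c₁ ^ 2 := by
  have hdet := gram_det_ne_zero hy hc₁ hv hMZ
  set Q : Sph q → ℝ := fun x => ∑ k, (gram C v y)⁻¹ ⟨0, hN⟩ k * y k x with hQ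
  have hQPi : InPi q n Q := InPi.sum_mul hy.1 _
  have h1 : InPi q n fun _ => 1 := ⟨1, by simp, by simp⟩
  have hD : InPi q n fun x => 1 * Q x + (-1) * 1 := hQPi.linear_combination h1 1 (-1)
  set D : Sph q → ℝ := fun x => 1 * Q x + (-1) * 1 with hDdef
  set E := ∫ x, D x ^ 2 ∂μ
  have hn0 : (0 : ℝ) < n := by exact_mod_cast hn
  have hnq : (0 : ℝ) < (n : ℝ) ^ q := pow_pos hn0 q
  set ε := c₀ / (n : ℝ) ^ q with hε
  have hε0 : 0 < ε := div_pos hc₀ hnq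
  have hE0 : 0 ≤ E := integral_nonneg fun x => sq_nonneg _
  have hlow : c₁ ^ 2 * E ≤ ∫ x, D x ∂μ - ∑ ξ ∈ C, v ξ * D ξ := by
    rw [← sum_density_mul hN hy hdet hD, ← Finset.sum_sub_distrib]
    refine (hMZ.integral_sq_le hc₁ hv hD).trans_eq (Finset.sum_congr rfl fun x _ => ?_)
    change v x * D x ^ 2 = v x * (Q x * D x) - v x * D x
    rw [hDdef]
    ring
  have hEle : (c₁ ^ 2) ^ 2 * E ≤ ε ^ 2 := by
    have ht := two_mul_sub_le h h1 hD (c₁ ^ 2 / ε)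
    have ht' : 2 * (c₁ ^ 2 / ε) * (c₁ ^ 2 * E) ≤ ε * (1 + (c₁ ^ 2 / ε) ^ 2 * E) :=
      (mul_le_mul_of_nonneg_left hlow (by positivity)).trans ht
    have := mul_le_mul_of_nonneg_left ht' hε0.le
    have e1 : ε * (2 * (c₁ ^ 2 / ε) * (c₁ ^ 2 * E)) = 2 * ((c₁ ^ 2) ^ 2 * E) := by
      field_simp
    have e2 : ε * (ε * (1 + (c₁ ^ 2 / ε) ^ 2 * E)) = ε ^ 2 + (c₁ ^ 2) ^ 2 * E := by
      field_simp
    linarith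
  have hDξ : |D ξ| ≤ 2 ^ (q + 1) * c₀ / c₁ ^ 2 := by
    refine abs_le_of_sq_le_sq ?_ (by positivity)
    have hNle : (N : ℝ) ≤ (2 ^ (q + 1) * (n : ℝ) ^ q) ^ 2 := by
      exact_mod_cast hy.card_le_pow hq hn
    have hE' : E ≤ (ε / c₁ ^ 2) ^ 2 := by
      rw [div_pow, le_div_iff₀ (by positivity), mul_comm]
      exact hEle
    calc D ξ ^ 2 ≤ N * E := hy.sq_le_integral hrot hD ξ
      _ ≤ (2 ^ (q + 1) * (n : ℝ) ^ q) ^ 2 * (ε / c₁ ^ 2) ^ 2 :=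
        mul_le_mul hNle hE' hE0 (by positivity)
      _ = (2 ^ (q + 1) * c₀ / c₁ ^ 2) ^ 2 := by
        rw [← mul_pow, hε]
        congr 1
        field_simp
  have hQD : Q ξ = 1 + D ξ := by rw [hDdef]; ring
  change |Q ξ| ≤ _
  rw [hQD]
  refine (abs_add_le _ _).trans ?_
  rw [abs_one]
  gcongr

/-- Under the additional strong M–Z condition, `|w_ξ^{LSQ}| ≤ c v_ξ`; in particular the
least squares weights satisfy the M–Z condition. -/
theorem statement11 (q : ℕ) (hq : 1 ≤ q)
    (μ : Measure (Sph q)) (hμ : IsProbabilityMeasure μ) (hrot : RotInvariant q μ)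
    (c₀ c₁ c₂ : ℝ) (hc₀ : 0 < c₀) (hc₁ : 0 < c₁) (hc₂ : 0 < c₂) :
    ∃ c c' : ℝ, 0 < c ∧ 0 < c' ∧
      ∀ n N : ℕ, 1 ≤ n → ∀ (hN : 0 < N) (y : Fin N → Sph q → ℝ), GoodPolyBasis q n N μ y →
      ∀ (C : Finset (Sph q)) (v : Sph q → ℝ), (∀ ξ ∈ C, 0 ≤ v ξ) →
        VMZ q n μ C v c₁ c₂ →
        (∀ P : Sph q → ℝ, InPi q n P →
          |(∑ ξ ∈ C, v ξ * P ξ ^ 2) - ∫ x, P x ^ 2 ∂μ| ≤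
            c₀ / (n : ℝ) ^ q * ∫ x, P x ^ 2 ∂μ) →
        (∀ ξ ∈ C, |wLSQ C v y ⟨0, hN⟩ ξ| ≤ c * v ξ) ∧
        (∀ P : Sph q → ℝ, InPi q n P → ∀ p : ℝ, 1 ≤ p →
          (∑ ξ ∈ C, |wLSQ C v y ⟨0, hN⟩ ξ| * |P ξ| ^ p) ^ (1 / p) ≤
            c' * (∫ x, |P x| ^ p ∂μ) ^ (1 / p)) := by
  set c : ℝ := 1 + 2 ^ (q + 1) * c₀ / c₁ ^ 2
  have hc : 1 ≤ c := le_add_of_nonneg_right (by positivity)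
  have hc0 : 0 < c := one_pos.trans_le hc
  refine ⟨c, c * c₂, hc0, by positivity, ?_⟩
  intro n N hn hN y hy C v hv hMZ hstrong
  have hw : ∀ ξ ∈ C, |wLSQ C v y ⟨0, hN⟩ ξ| ≤ c * v ξ := fun ξ hξ => by
    rw [wLSQ, abs_mul, abs_of_nonneg (hv ξ hξ), mul_comm]
    exact mul_le_mul_of_nonneg_right
      (abs_density_le hq hn hN hrot hc₀ hc₁ hy hv hMZ hstrong ξ) (hv ξ hξ)
  refine ⟨hw, fun P hP p hp => ?_⟩
  have hp0 : 0 < p := one_pos.trans_le hp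
  have hS : 0 ≤ ∑ ξ ∈ C, v ξ * |P ξ| ^ p :=
    Finset.sum_nonneg fun ξ hξ => mul_nonneg (hv ξ hξ) (by positivity)
  calc (∑ ξ ∈ C, |wLSQ C v y ⟨0, hN⟩ ξ| * |P ξ| ^ p) ^ (1 / p)
      ≤ (c * ∑ ξ ∈ C, v ξ * |P ξ| ^ p) ^ (1 / p) := by
        refine Real.rpow_le_rpow (Finset.sum_nonneg fun ξ _ => by positivity) ?_ (by positivity)
        rw [Finset.mul_sum]
        refine Finset.sum_le_sum fun ξ hξ => ?_
        rw [← mul_assoc]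
        exact mul_le_mul_of_nonneg_right (hw ξ hξ) (by positivity)
    _ = c ^ (1 / p) * (∑ ξ ∈ C, v ξ * |P ξ| ^ p) ^ (1 / p) := Real.mul_rpow hc0.le hS
    _ ≤ c * (c₂ * (∫ x, |P x| ^ p ∂μ) ^ (1 / p)) := by
        refine mul_le_mul ?_ (hMZ.1 P hP p hp).2 (by positivity) hc0.le
        calc c ^ (1 / p) ≤ c ^ (1 : ℝ) :=
              Real.rpow_le_rpow_of_exponent_le hc ((div_le_one hp0).2 hp)
          _ = c := Real.rpow_one c
    _ = c * c₂ * (∫ x, |P x| ^ p ∂μ) ^ (1 / p) := by ring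

end SD
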